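/- arXiv:1502.02344 — 6 statements merged into one kernel-verified Lean document; each statement's English description precedes it below -/
import Mathlib

section
/- Let ŵ ∈ ℝ^d, let C̃ > 0, for each i ∈ {1,…,n} let ξ_i ∈ ℝ^d be a subgradient of ℓ_i at ŵ, and set g = ŵ + C̃ Σ_{i=1}^n ξ_i. Then for every C > 0, every minimizer w*_C of F_C over ℝ^d lies in the closed ball of center (1/2)(ŵ − (C/C̃)(g − ŵ)) and radius (1/2)‖ŵ + (C/C̃)(g − ŵ)‖; that is, ‖w*_C − (1/2)(ŵ − (C/C̃)(g − ŵ))‖ ≤ (1/2)‖ŵ + (C/C̃)(g − ŵ)‖. -/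
open scoped RealInnerProductSpace

/-- The regularized objective F_C(w) = (1/2)‖w‖² + C Σ_i ℓ_i(w). -/
noncomputable def F {d n : ℕ} (ℓ : Fin n → EuclideanSpace ℝ (Fin d) → ℝ) (C : ℝ)
    (w : EuclideanSpace ℝ (Fin d)) : ℝ :=
  (1 / 2 : ℝ) * ‖w‖ ^ 2 + C * ∑ i, ℓ i w

/-- ξ is a subgradient of f at wh. -/
def IsSubgrad {d : ℕ} (f : EuclideanSpace ℝ (Fin d) → ℝ)
    (ξ wh : EuclideanSpace ℝ (Fin d)) : Prop :=
  ∀ w, f wh + ⟪ξ, w - wh⟫ ≤ f w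

/-- α(u,x) = (1/2)(‖u‖‖x‖ + ⟨u,x⟩);  γ(g,x) = α(g,x). -/
noncomputable def alph {d : ℕ} (u x : EuclideanSpace ℝ (Fin d)) : ℝ :=
  (1 / 2 : ℝ) * (‖u‖ * ‖x‖ + ⟪u, x⟫)

/-- β(u,x) = (1/2)(‖u‖‖x‖ − ⟨u,x⟩);  δ(g,x) = β(g,x). -/
noncomputable def bet {d : ℕ} (u x : EuclideanSpace ℝ (Fin d)) : ℝ :=
  (1 / 2 : ℝ) * (‖u‖ * ‖x‖ - ⟪u, x⟫)

theorem stmt4 {d n : ℕ} (ℓ : Fin n → EuclideanSpace ℝ (Fin d) → ℝ)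
    (hconv : ∀ i, ConvexOn ℝ Set.univ (ℓ i))
    (wh : EuclideanSpace ℝ (Fin d)) (Ct : ℝ) (hCt : 0 < Ct)
    (ξ : Fin n → EuclideanSpace ℝ (Fin d)) (hξ : ∀ i, IsSubgrad (ℓ i) (ξ i) wh)
    (g : EuclideanSpace ℝ (Fin d)) (hg : g = wh + Ct • ∑ i, ξ i)
    (C : ℝ) (hC : 0 < C)
    (w : EuclideanSpace ℝ (Fin d)) (hw : ∀ v, F ℓ C w ≤ F ℓ C v) :
    ‖w - (1 / 2 : ℝ) • (wh - (C / Ct) • (g - wh))‖ ≤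
      (1 / 2 : ℝ) * ‖wh + (C / Ct) • (g - wh)‖ := by
  have hS : (C / Ct) • (g - wh) = C • ∑ i, ξ i := by
    rw [hg, add_sub_cancel_left, smul_smul, div_mul_cancel₀ _ hCt.ne']
  rw [hS]
  have hsub : C * ∑ i, ℓ i wh + ⟪C • ∑ i, ξ i, w - wh⟫ ≤ C * ∑ i, ℓ i w := by
    rw [real_inner_smul_left, sum_inner, ← mul_add, ← Finset.sum_add_distrib]
    exact mul_le_mul_of_nonneg_left (Finset.sum_le_sum fun i _ => hξ i w) hC.le
  generalize C • ∑ i, ξ i = s at hsub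
  have key : ∀ t : ℝ, 0 < t → t ≤ 1 →
      0 ≤ (⟪w, wh - w⟫ + (C * ∑ i, ℓ i wh - C * ∑ i, ℓ i w)) + t * (‖wh - w‖ ^ 2 / 2) := by
    intro t ht ht1
    have h1 := hw (w + t • (wh - w))
    have h2 : ∑ i, ℓ i (w + t • (wh - w)) ≤ (1 - t) * ∑ i, ℓ i w + t * ∑ i, ℓ i wh := by
      rw [Finset.mul_sum, Finset.mul_sum, ← Finset.sum_add_distrib]
      refine Finset.sum_le_sum fun i _ => ?_
      have h3 := (hconv i).2 (Set.mem_univ w) (Set.mem_univ wh)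
        (sub_nonneg.2 ht1) ht.le (by ring)
      have h4 : (1 - t) • w + t • wh = w + t • (wh - w) := by module
      rw [h4] at h3
      simpa using h3
    have h5 := mul_le_mul_of_nonneg_left h2 hC.le
    unfold F at h1
    rw [norm_add_sq_real, real_inner_smul_right, norm_smul, mul_pow, Real.norm_eq_abs,
      sq_abs] at h1
    refine nonneg_of_mul_nonneg_right (a := t) ?_ ht
    nlinarith
  have hA : 0 ≤ ⟪w, wh - w⟫ + (C * ∑ i, ℓ i wh - C * ∑ i, ℓ i w) := by
    by_contra! hneg
    set A := ⟪w, wh - w⟫ + (C * ∑ i, ℓ i wh - C * ∑ i, ℓ i w) with hAdef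
    have hB : 0 ≤ ‖wh - w‖ ^ 2 / 2 := by positivity
    set B := ‖wh - w‖ ^ 2 / 2 with hBdef
    have hpos : 0 < B - A := by linarith
    have h := key (-A / (B - A) / 2) (by apply div_pos (div_pos _ hpos) <;> linarith) (by
      rw [div_div, div_le_one (by linarith)]; linarith)
    have h6 : -A / (B - A) / 2 * B ≤ -A / 2 := by
      rw [div_div, div_mul_eq_mul_div, div_le_div_iff₀ (by linarith) (by norm_num)]
      nlinarith
    linarith
  have hfin : ⟪w, wh - w⟫ - ⟪s, w - wh⟫ ≥ 0 := by linarith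
  refine (sq_le_sq₀ (norm_nonneg _) (by positivity)).1 ?_
  rw [mul_pow, ← real_inner_self_eq_norm_sq, ← real_inner_self_eq_norm_sq]
  simp only [inner_sub_left, inner_sub_right, inner_add_left, inner_add_right,
    real_inner_smul_left, real_inner_smul_right] at hfin ⊢
  have e1 := real_inner_comm w wh
  have e2 := real_inner_comm s wh
  have e3 := real_inner_comm s w
  nlinarith
end

section
/- Let ŵ ∈ ℝ^d, let C̃ > 0, for each i ∈ {1,…,n} let ξ_i ∈ ℝ^d be a subgradient of ℓ_i at ŵ, and set g = ŵ + C̃ Σ_{i=1}^n ξ_i. Then for every C with C ≥ C̃, every minimizer w*_C of F_C over ℝ^d, and every x ∈ ℝ^d: ⟨w*_C, x⟩ ≥ α(ŵ,x) − (C/C̃)·(β(ŵ,x) + γ(g,x)). -/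
open scoped RealInnerProductSpace

theorem stmt5 {d n : ℕ} (ℓ : Fin n → EuclideanSpace ℝ (Fin d) → ℝ)
    (hconv : ∀ i, ConvexOn ℝ Set.univ (ℓ i))
    (wh : EuclideanSpace ℝ (Fin d)) (Ct : ℝ) (hCt : 0 < Ct)
    (ξ : Fin n → EuclideanSpace ℝ (Fin d)) (hξ : ∀ i, IsSubgrad (ℓ i) (ξ i) wh)
    (g : EuclideanSpace ℝ (Fin d)) (hg : g = wh + Ct • ∑ i, ξ i)
    (C : ℝ) (hC : Ct ≤ C)
    (w : EuclideanSpace ℝ (Fin d)) (hw : ∀ v, F ℓ C w ≤ F ℓ C v)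
    (x : EuclideanSpace ℝ (Fin d)) :
    alph wh x - (C / Ct) * (bet wh x + alph g x) ≤ ⟪w, x⟫ := by
  have hCp : 0 < C := lt_of_lt_of_le hCt hC
  have hstrong : ∀ t : ℝ, 0 < t → t < 1 →
      (1 - t) * ((1 / 2 : ℝ) * ‖w - wh‖ ^ 2) ≤ F ℓ C wh - F ℓ C w := by
    intro t ht0 ht1
    have h1 := hw ((1 - t) • w + t • wh)
    have h2 : ∑ i, ℓ i ((1 - t) • w + t • wh) ≤ ∑ i, ((1 - t) * ℓ i w + t * ℓ i wh) := by
      apply Finset.sum_le_sum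
      intro i _
      have := (hconv i).2 (Set.mem_univ w) (Set.mem_univ wh) (sub_nonneg.2 ht1.le) ht0.le
        (by ring)
      simpa [smul_eq_mul] using this
    rw [Finset.sum_add_distrib, ← Finset.mul_sum, ← Finset.mul_sum] at h2
    have h2' := mul_le_mul_of_nonneg_left h2 hCp.le
    have h3 : ‖(1 - t) • w + t • wh‖ ^ 2
        = (1 - t) * ‖w‖ ^ 2 + t * ‖wh‖ ^ 2 - t * (1 - t) * ‖w - wh‖ ^ 2 := by
      rw [norm_add_sq_real, norm_sub_sq_real, norm_smul, norm_smul, real_inner_smul_left,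
        real_inner_smul_right, mul_pow, mul_pow, Real.norm_eq_abs, Real.norm_eq_abs,
        sq_abs, sq_abs]
      ring
    unfold F at *
    rw [h3] at h1
    refine le_of_mul_le_mul_left ?_ ht0
    linarith
  have hsc : (1 / 2 : ℝ) * ‖w - wh‖ ^ 2 ≤ F ℓ C wh - F ℓ C w := by
    have hE : 0 ≤ F ℓ C wh - F ℓ C w := sub_nonneg.2 (hw wh)
    by_contra hcon
    push Not at hcon
    generalize (1 / 2 : ℝ) * ‖w - wh‖ ^ 2 = D at *
    generalize F ℓ C wh - F ℓ C w = E at *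
    have hD : 0 < D := by linarith
    have h := hstrong ((D - E) / (2 * D)) (div_pos (by linarith) (by linarith))
      (by rw [div_lt_one (by linarith)]; linarith)
    have h' : (1 - (D - E) / (2 * D)) * D = (D + E) / 2 := by
      field_simp
      ring
    linarith
  have hsub : ∑ i, ℓ i wh + ⟪∑ i, ξ i, w - wh⟫ ≤ ∑ i, ℓ i w := by
    rw [sum_inner, ← Finset.sum_add_distrib]
    exact Finset.sum_le_sum fun i _ => hξ i w
  obtain ⟨r, hr⟩ : ∃ r, r = C / Ct := ⟨_, rfl⟩
  have hr1 : 1 ≤ r := by rw [hr, one_le_div hCt]; exact hC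
  have hCr : C = r * Ct := by rw [hr]; field_simp
  have hgi : C * ⟪∑ i, ξ i, w - wh⟫ = r * ⟪g - wh, w - wh⟫ := by
    rw [hg, add_sub_cancel_left, real_inner_smul_left, hCr]; ring
  have hsub' := mul_le_mul_of_nonneg_left hsub hCp.le
  have key : (1 / 2 : ℝ) * ‖w - wh‖ ^ 2 + r * ⟪g - wh, w - wh⟫
      ≤ 1 / 2 * ‖wh‖ ^ 2 - 1 / 2 * ‖w‖ ^ 2 := by
    unfold F at hsc
    rw [mul_add, hgi] at hsub'
    linarith
  have hball : ‖w - (1 / 2 : ℝ) • (wh + r • (wh - g))‖ ^ 2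
      ≤ ‖(1 / 2 : ℝ) • ((1 - r) • wh + r • g)‖ ^ 2 := by
    simp only [← real_inner_self_eq_norm_sq, inner_sub_left, inner_sub_right, inner_add_left,
      inner_add_right, real_inner_smul_left, real_inner_smul_right] at key ⊢
    rw [real_inner_comm w wh, real_inner_comm w g, real_inner_comm wh g] at *
    nlinarith [key]
  have hball' := le_of_sq_le_sq hball (norm_nonneg _)
  have hrad : ‖(1 / 2 : ℝ) • ((1 - r) • wh + r • g)‖ ≤ 1 / 2 * ((r - 1) * ‖wh‖ + r * ‖g‖) := by
    rw [norm_smul, Real.norm_of_nonneg (by norm_num)]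
    have := norm_add_le ((1 - r) • wh) (r • g)
    rw [norm_smul, norm_smul, Real.norm_of_nonneg (by linarith : 0 ≤ r),
      Real.norm_of_nonpos (by linarith : 1 - r ≤ 0)] at this
    linarith
  have hcs := neg_le_of_abs_le (abs_real_inner_le_norm (w - (1 / 2 : ℝ) • (wh + r • (wh - g))) x)
  have hm := mul_le_mul_of_nonneg_right (hball'.trans hrad) (norm_nonneg x)
  have hin : ⟪w - (1 / 2 : ℝ) • (wh + r • (wh - g)), x⟫
      = ⟪w, x⟫ - 1 / 2 * (⟪wh, x⟫ + r * (⟪wh, x⟫ - ⟪g, x⟫)) := by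
    simp only [inner_sub_left, inner_add_left, real_inner_smul_left]
  rw [hin] at hcs
  rw [← hr]
  unfold alph bet
  linarith
end

section
/- Let ŵ ∈ ℝ^d, let C̃ > 0, for each i ∈ {1,…,n} let ξ_i ∈ ℝ^d be a subgradient of ℓ_i at ŵ, and set g = ŵ + C̃ Σ_{i=1}^n ξ_i. Then for every C with C ≥ C̃, every minimizer w*_C of F_C over ℝ^d, and every x ∈ ℝ^d: ⟨w*_C, x⟩ ≤ −β(ŵ,x) + (C/C̃)·(α(ŵ,x) + δ(g,x)). -/
open scoped RealInnerProductSpace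

theorem stmt7 {d n : ℕ} (ℓ : Fin n → EuclideanSpace ℝ (Fin d) → ℝ)
    (hconv : ∀ i, ConvexOn ℝ Set.univ (ℓ i))
    (wh : EuclideanSpace ℝ (Fin d)) (Ct : ℝ) (hCt : 0 < Ct)
    (ξ : Fin n → EuclideanSpace ℝ (Fin d)) (hξ : ∀ i, IsSubgrad (ℓ i) (ξ i) wh)
    (g : EuclideanSpace ℝ (Fin d)) (hg : g = wh + Ct • ∑ i, ξ i)
    (C : ℝ) (hC : Ct ≤ C)
    (w : EuclideanSpace ℝ (Fin d)) (hw : ∀ v, F ℓ C w ≤ F ℓ C v)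
    (x : EuclideanSpace ℝ (Fin d)) :
    ⟪w, x⟫ ≤ -bet wh x + (C / Ct) * (alph wh x + bet g x) := by
  classical
  have hC0 : 0 < C := lt_of_lt_of_le hCt hC
  set L : EuclideanSpace ℝ (Fin d) → ℝ := fun v => ∑ i, ℓ i v with hL
  set s : EuclideanSpace ℝ (Fin d) := ∑ i, ξ i with hs
  have hsub : L wh + ⟪s, w - wh⟫ ≤ L w := by
    rw [hs, sum_inner, hL]
    simp only
    rw [← Finset.sum_add_distrib]
    exact Finset.sum_le_sum fun i _ => hξ i w
  have hLc : ∀ t : ℝ, 0 ≤ t → t ≤ 1 →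
      L (w + t • (wh - w)) ≤ (1 - t) * L w + t * L wh := by
    intro t h0 h1
    simp only [hL]
    rw [Finset.mul_sum, Finset.mul_sum, ← Finset.sum_add_distrib]
    refine Finset.sum_le_sum fun i _ => ?_
    have h := (hconv i).2 (Set.mem_univ w) (Set.mem_univ wh)
      (sub_nonneg.2 h1) h0 (by ring : (1 - t) + t = 1)
    have e : w + t • (wh - w) = (1 - t) • w + t • wh := by module
    rw [e]
    simpa only [smul_eq_mul] using h
  have key : ∀ t : ℝ, 0 < t → t ≤ 1 →
      0 ≤ ⟪w, wh - w⟫ + C * (L wh - L w) + t / 2 * ‖wh - w‖ ^ 2 := by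
    intro t h0 h1
    have h := hw (w + t • (wh - w))
    have h2 := hLc t h0.le h1
    have h3 : (1 / 2 : ℝ) * ‖w‖ ^ 2 + C * L w
      ≤ (1 / 2 : ℝ) * ‖w + t • (wh - w)‖ ^ 2 + C * L (w + t • (wh - w)) := h
    rw [norm_add_sq_real, inner_smul_right, norm_smul, mul_pow, Real.norm_eq_abs, sq_abs] at h3
    have h4 := mul_le_mul_of_nonneg_left h2 hC0.le
    have h5 : 0 ≤ t * (⟪w, wh - w⟫ + C * (L wh - L w) + t / 2 * ‖wh - w‖ ^ 2) := by
      linarith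
    exact nonneg_of_mul_nonneg_right h5 h0
  have opt : 0 ≤ ⟪w, wh - w⟫ + C * (L wh - L w) := by
    set a := ⟪w, wh - w⟫ + C * (L wh - L w) with ha
    by_contra! hneg
    set D := ‖wh - w‖ ^ 2 with hD
    have hD0 : 0 ≤ D := by positivity
    have hpos : 0 < -a / (D + 1) := div_pos (by linarith) (by linarith)
    have h := key (min 1 (-a / (D + 1))) (lt_min one_pos hpos) (min_le_left _ _)
    have h2 : min 1 (-a / (D + 1)) * D ≤ -a / (D + 1) * D :=
      mul_le_mul_of_nonneg_right (min_le_right _ _) hD0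
    have h3 : -a / (D + 1) * (D + 1) = -a := div_mul_cancel₀ _ (by linarith)
    linarith
  set k := C / Ct with hk
  have hk1 : 1 ≤ k := (one_le_div hCt).2 hC
  have hCs : C • s = k • (g - wh) := by
    rw [hg, add_sub_cancel_left, smul_smul, hk, div_mul_cancel₀ _ hCt.ne']
  have hb : ⟪w + k • (g - wh), w - wh⟫ ≤ 0 := by
    rw [← hCs, inner_add_left, real_inner_smul_left]
    have h1 := mul_le_mul_of_nonneg_left hsub hC0.le
    have h2 : ⟪w, wh - w⟫ = -⟪w, w - wh⟫ := by rw [← inner_neg_right, neg_sub]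
    linarith
  -- ball with center c and radius ‖q‖
  set c : EuclideanSpace ℝ (Fin d) := (1 / 2 : ℝ) • ((1 + k) • wh - k • g) with hc
  set q : EuclideanSpace ℝ (Fin d) := (1 / 2 : ℝ) • (k • g - (k - 1) • wh) with hq
  have e1 : w + k • (g - wh) = (w - c) + q := by rw [hc, hq]; module
  have e2 : w - wh = (w - c) - q := by rw [hc, hq]; module
  have hr : ‖w - c‖ ≤ ‖q‖ := by
    rw [e1, e2, inner_add_left, inner_sub_right _ (w - c) q, inner_sub_right _ (w - c) q,
      real_inner_self_eq_norm_sq, real_inner_self_eq_norm_sq] at hb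
    exact le_of_sq_le_sq (by linarith [real_inner_comm (w - c) q]) (norm_nonneg _)
  have hqn : ‖q‖ ≤ 1 / 2 * (k * ‖g‖ + (k - 1) * ‖wh‖) := by
    rw [hq, norm_smul, Real.norm_of_nonneg (by norm_num : (0 : ℝ) ≤ 1 / 2)]
    have h := norm_sub_le (k • g) ((k - 1) • wh)
    rw [norm_smul, norm_smul, Real.norm_of_nonneg (by linarith : 0 ≤ k),
      Real.norm_of_nonneg (by linarith : 0 ≤ k - 1)] at h
    linarith
  have h1 : ⟪w - c, x⟫ ≤ 1 / 2 * (k * ‖g‖ + (k - 1) * ‖wh‖) * ‖x‖ :=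
    (real_inner_le_norm _ _).trans
      (mul_le_mul_of_nonneg_right (hr.trans hqn) (norm_nonneg _))
  have h2 : ⟪c, x⟫ = 1 / 2 * ((1 + k) * ⟪wh, x⟫ - k * ⟪g, x⟫) := by
    rw [hc, real_inner_smul_left, inner_sub_left, real_inner_smul_left, real_inner_smul_left]
  rw [inner_sub_left, h2] at h1
  unfold bet alph
  linarith
end

section
/- Let ŵ ∈ ℝ^d, let C̃ > 0, for each i ∈ {1,…,n} let ξ_i ∈ ℝ^d be a subgradient of ℓ_i at ŵ, and set g = ŵ + C̃ Σ_{i=1}^n ξ_i. Then every minimizer w*_{C̃} of F_{C̃} over ℝ^d satisfies, for every x ∈ ℝ^d: ⟨ŵ, x⟩ − γ(g,x) ≤ ⟨w*_{C̃}, x⟩ ≤ ⟨ŵ, x⟩ + δ(g,x). -/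
open scoped RealInnerProductSpace

theorem stmt9 {d n : ℕ} (ℓ : Fin n → EuclideanSpace ℝ (Fin d) → ℝ)
    (hconv : ∀ i, ConvexOn ℝ Set.univ (ℓ i))
    (wh : EuclideanSpace ℝ (Fin d)) (Ct : ℝ) (hCt : 0 < Ct)
    (ξ : Fin n → EuclideanSpace ℝ (Fin d)) (hξ : ∀ i, IsSubgrad (ℓ i) (ξ i) wh)
    (g : EuclideanSpace ℝ (Fin d)) (hg : g = wh + Ct • ∑ i, ξ i)
    (w : EuclideanSpace ℝ (Fin d)) (hw : ∀ v, F ℓ Ct w ≤ F ℓ Ct v)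
    (x : EuclideanSpace ℝ (Fin d)) :
    ⟪wh, x⟫ - alph g x ≤ ⟪w, x⟫ ∧ ⟪w, x⟫ ≤ ⟪wh, x⟫ + bet g x := by
  have key : ∀ t : ℝ, 0 < t → t ≤ 1 →
      ⟪w, w - wh⟫ - Ct * (∑ i, ℓ i wh - ∑ i, ℓ i w) ≤ t / 2 * ‖w - wh‖ ^ 2 := by
    intro t ht ht1
    have h1 := hw ((1 - t) • w + t • wh)
    have h2 : ∑ i, ℓ i ((1 - t) • w + t • wh) ≤ (1 - t) * ∑ i, ℓ i w + t * ∑ i, ℓ i wh := by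
      rw [Finset.mul_sum, Finset.mul_sum, ← Finset.sum_add_distrib]
      refine Finset.sum_le_sum fun i _ => ?_
      simpa using (hconv i).2 (Set.mem_univ w) (Set.mem_univ wh) (by linarith : 0 ≤ 1 - t)
        ht.le (by ring)
    have h3 : (1 - t) • w + t • wh = w - t • (w - wh) := by module
    have h4 : ‖(1 - t) • w + t • wh‖ ^ 2
        = ‖w‖ ^ 2 - 2 * (t * ⟪w, w - wh⟫) + t ^ 2 * ‖w - wh‖ ^ 2 := by
      rw [h3, norm_sub_sq_real, real_inner_smul_right, norm_smul, mul_pow, Real.norm_eq_abs,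
        sq_abs]
    have h5 := mul_le_mul_of_nonneg_left h2 hCt.le
    unfold F at h1
    rw [h4] at h1
    refine le_of_mul_le_mul_left ?_ ht
    nlinarith
  have hA : ⟪w, w - wh⟫ - Ct * (∑ i, ℓ i wh - ∑ i, ℓ i w) ≤ 0 := by
    generalize ⟪w, w - wh⟫ - Ct * (∑ i, ℓ i wh - ∑ i, ℓ i w) = A at key
    have hN : 0 ≤ ‖w - wh‖ ^ 2 := by positivity
    generalize ‖w - wh‖ ^ 2 = N at key hN
    by_contra! h
    have h1 := key (A / (A + N)) (by positivity) (by rw [div_le_one (by positivity)]; linarith)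
    have h2 : A / (A + N) * (A + N) = A := div_mul_cancel₀ _ (by positivity)
    have h3 : 0 < A / (A + N) := by positivity
    nlinarith [mul_pos h3 h]
  have hS : ∑ i, ℓ i wh + ⟪∑ i, ξ i, w - wh⟫ ≤ ∑ i, ℓ i w := by
    rw [sum_inner, ← Finset.sum_add_distrib]
    exact Finset.sum_le_sum fun i _ => hξ i w
  have hS' := mul_le_mul_of_nonneg_left hS hCt.le
  have hgD : ⟪g, w - wh⟫ = ⟪wh, w - wh⟫ + Ct * ⟪∑ i, ξ i, w - wh⟫ := by
    rw [hg, inner_add_left, real_inner_smul_left]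
  have hD : ‖w - wh‖ ^ 2 + ⟪g, w - wh⟫ ≤ 0 := by
    rw [← real_inner_self_eq_norm_sq]
    nth_rewrite 1 [inner_sub_left]
    linarith
  have hn : ‖(w - wh) + (1 / 2 : ℝ) • g‖ ≤ 1 / 2 * ‖g‖ := by
    refine (sq_le_sq₀ (norm_nonneg _) (by positivity)).1 ?_
    rw [norm_add_sq_real, real_inner_smul_right, real_inner_comm, norm_smul, mul_pow,
      Real.norm_eq_abs, sq_abs]
    linarith
  have hc := abs_le.1 ((abs_real_inner_le_norm ((w - wh) + (1 / 2 : ℝ) • g) x).trans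
    (mul_le_mul_of_nonneg_right hn (norm_nonneg x)))
  rw [inner_add_left, inner_sub_left, real_inner_smul_left] at hc
  unfold alph bet
  constructor <;> linarith [hc.1, hc.2]
end

section
/- Let ŵ ∈ ℝ^d, let C̃ > 0, for each i ∈ {1,…,n} let ξ_i ∈ ℝ^d be a subgradient of ℓ_i at ŵ, and set g = ŵ + C̃ Σ_{i=1}^n ξ_i. Then every minimizer w*_{C̃} of F_{C̃} over ℝ^d satisfies: #{i : y'_i·⟨w*_{C̃}, x'_i⟩ < 0} ≥ #{i : y'_i = +1, ⟨ŵ, x'_i⟩ + δ(g, x'_i) < 0} + #{i : y'_i = −1, ⟨ŵ, x'_i⟩ − γ(g, x'_i) > 0}. Equivalently, E_v(w*_{C̃}) ≥ (1/n')·(#{i : y'_i = +1, ⟨ŵ, x'_i⟩ + δ(g, x'_i) < 0} + #{i : y'_i = −1, ⟨ŵ, x'_i⟩ − γ(g, x'_i) > 0}). -/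
open scoped RealInnerProductSpace

theorem key {d n : ℕ} (ℓ : Fin n → EuclideanSpace ℝ (Fin d) → ℝ)
    (hconv : ∀ i, ConvexOn ℝ Set.univ (ℓ i))
    (wh : EuclideanSpace ℝ (Fin d)) (Ct : ℝ) (hCt : 0 < Ct)
    (ξ : Fin n → EuclideanSpace ℝ (Fin d)) (hξ : ∀ i, IsSubgrad (ℓ i) (ξ i) wh)
    (g : EuclideanSpace ℝ (Fin d)) (hg : g = wh + Ct • ∑ i, ξ i)
    (w : EuclideanSpace ℝ (Fin d)) (hw : ∀ v, F ℓ Ct w ≤ F ℓ Ct v) :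
    ‖w - wh‖ ^ 2 + ⟪g, w - wh⟫ ≤ 0 := by
  have hD : ‖w - wh‖ ^ 2 = ‖w‖ ^ 2 - 2 * ⟪w, wh⟫ + ‖wh‖ ^ 2 := norm_sub_sq_real w wh
  have h1 : ∀ t : ℝ, 0 < t → t < 1 →
      (1 - t) * ((1 / 2) * ‖w - wh‖ ^ 2) ≤ F ℓ Ct wh - F ℓ Ct w := by
    intro t ht0 ht1
    have h := hw ((1 - t) • w + t • wh)
    have hS : ∑ i, ℓ i ((1 - t) • w + t • wh)
        ≤ (1 - t) * ∑ i, ℓ i w + t * ∑ i, ℓ i wh := by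
      rw [Finset.mul_sum, Finset.mul_sum, ← Finset.sum_add_distrib]
      refine Finset.sum_le_sum fun i _ => ?_
      have := (hconv i).2 (Set.mem_univ w) (Set.mem_univ wh)
        (by linarith : (0 : ℝ) ≤ 1 - t) ht0.le (by ring)
      simpa using this
    have hN : ‖(1 - t) • w + t • wh‖ ^ 2
        = (1 - t) ^ 2 * ‖w‖ ^ 2 + 2 * ((1 - t) * t * ⟪w, wh⟫) + t ^ 2 * ‖wh‖ ^ 2 := by
      rw [norm_add_sq_real, norm_smul, norm_smul, inner_smul_left, inner_smul_right,
        mul_pow, mul_pow, Real.norm_eq_abs, Real.norm_eq_abs, sq_abs, sq_abs]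
      simp only [conj_trivial]
      ring
    have hS' := mul_le_mul_of_nonneg_left hS hCt.le
    unfold F at h ⊢
    rw [hN] at h
    rw [hD]
    refine le_of_mul_le_mul_left ?_ ht0
    nlinarith
  have h2 : (1 / 2) * ‖w - wh‖ ^ 2 ≤ F ℓ Ct wh - F ℓ Ct w := by
    by_contra! hlt
    have hK0 : 0 ≤ F ℓ Ct wh - F ℓ Ct w := sub_nonneg.2 (hw wh)
    generalize (1 / 2) * ‖w - wh‖ ^ 2 = A at *
    generalize F ℓ Ct wh - F ℓ Ct w = K at *
    have hA : 0 < A := by linarith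
    have h := h1 ((A - K) / (2 * A)) (by apply div_pos <;> linarith)
      (by rw [div_lt_one] <;> linarith)
    have e : (1 - (A - K) / (2 * A)) * A = (A + K) / 2 := by
      field_simp
      ring
    linarith
  have h3 : F ℓ Ct wh + ⟪g, w - wh⟫ + (1 / 2) * ‖w - wh‖ ^ 2 ≤ F ℓ Ct w := by
    have hS : ∑ i, ℓ i wh + ⟪∑ i, ξ i, w - wh⟫ ≤ ∑ i, ℓ i w := by
      rw [sum_inner, ← Finset.sum_add_distrib]
      exact Finset.sum_le_sum fun i _ => hξ i w
    have hS' := mul_le_mul_of_nonneg_left hS hCt.le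
    have e : ⟪g, w - wh⟫ = ⟪w, wh⟫ - ‖wh‖ ^ 2 + Ct * ⟪∑ i, ξ i, w - wh⟫ := by
      rw [hg, inner_add_left, real_inner_smul_left, inner_sub_right wh,
        real_inner_self_eq_norm_sq, real_inner_comm]
    unfold F
    rw [e, hD]
    nlinarith
  linarith

theorem inner_bounds {d : ℕ} {w wh g : EuclideanSpace ℝ (Fin d)}
    (h : ‖w - wh‖ ^ 2 + ⟪g, w - wh⟫ ≤ 0) (x : EuclideanSpace ℝ (Fin d)) :
    ⟪w, x⟫ ≤ ⟪wh, x⟫ + bet g x ∧ ⟪wh, x⟫ - alph g x ≤ ⟪w, x⟫ := by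
  have hn : ‖(2 : ℝ) • (w - wh) + g‖ ≤ ‖g‖ := by
    refine le_trans (le_abs_self _) (abs_le_of_sq_le_sq ?_ (norm_nonneg g))
    rw [norm_add_sq_real, norm_smul, real_inner_smul_left, real_inner_comm, mul_pow]
    norm_num
    linarith
  have hc := abs_le.1 ((abs_real_inner_le_norm ((2 : ℝ) • (w - wh) + g) x).trans
    (mul_le_mul_of_nonneg_right hn (norm_nonneg x)))
  rw [inner_add_left, real_inner_smul_left, inner_sub_left] at hc
  unfold bet alph
  constructor <;> linarith [hc.1, hc.2]

theorem stmt13 {d n : ℕ} (ℓ : Fin n → EuclideanSpace ℝ (Fin d) → ℝ)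
    (hconv : ∀ i, ConvexOn ℝ Set.univ (ℓ i))
    (wh : EuclideanSpace ℝ (Fin d)) (Ct : ℝ) (hCt : 0 < Ct)
    (ξ : Fin n → EuclideanSpace ℝ (Fin d)) (hξ : ∀ i, IsSubgrad (ℓ i) (ξ i) wh)
    (g : EuclideanSpace ℝ (Fin d)) (hg : g = wh + Ct • ∑ i, ξ i)
    (n' : ℕ) (x' : Fin n' → EuclideanSpace ℝ (Fin d)) (y' : Fin n' → ℝ)
    (hy : ∀ i, y' i = 1 ∨ y' i = -1)
    (w : EuclideanSpace ℝ (Fin d)) (hw : ∀ v, F ℓ Ct w ≤ F ℓ Ct v) :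
    {i : Fin n' | y' i = 1 ∧ ⟪wh, x' i⟫ + bet g (x' i) < 0}.ncard +
    {i : Fin n' | y' i = -1 ∧ 0 < ⟪wh, x' i⟫ - alph g (x' i)}.ncard ≤
    {i : Fin n' | y' i * ⟪w, x' i⟫ < 0}.ncard := by
  have hK := key ℓ hconv wh Ct hCt ξ hξ g hg w hw
  rw [← Set.ncard_union_eq _ (Set.toFinite _) (Set.toFinite _)]
  · apply Set.ncard_le_ncard _ (Set.toFinite _)
    rintro i (⟨h1, h2⟩ | ⟨h1, h2⟩)
    · have := (inner_bounds hK (x' i)).1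
      simp only [Set.mem_setOf_eq, h1]
      linarith
    · have := (inner_bounds hK (x' i)).2
      simp only [Set.mem_setOf_eq, h1]
      linarith
  · rw [Set.disjoint_left]
    rintro i ⟨h1, _⟩ ⟨h2, _⟩
    rw [h1] at h2
    norm_num at h2
end

section
/- Let ŵ ∈ ℝ^d, let C̃ > 0, for each i ∈ {1,…,n} let ξ_i ∈ ℝ^d be a subgradient of ℓ_i at ŵ, and set g = ŵ + C̃ Σ_{i=1}^n ξ_i. Then every minimizer w*_{C̃} of F_{C̃} over ℝ^d satisfies: #{i : y'_i·⟨w*_{C̃}, x'_i⟩ < 0} ≤ n' − (#{i : y'_i = +1, ⟨ŵ, x'_i⟩ − γ(g, x'_i) ≥ 0} + #{i : y'_i = −1, ⟨ŵ, x'_i⟩ + δ(g, x'_i) ≤ 0}). Equivalently, E_v(w*_{C̃}) ≤ 1 − (1/n')·(#{i : y'_i = +1, ⟨ŵ, x'_i⟩ − γ(g, x'_i) ≥ 0} + #{i : y'_i = −1, ⟨ŵ, x'_i⟩ + δ(g, x'_i) ≤ 0}). -/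
open scoped RealInnerProductSpace

/-- The minimizer lies in the ball with diameter from wh - g to wh. -/
theorem ball_aux {d n : ℕ} (ℓ : Fin n → EuclideanSpace ℝ (Fin d) → ℝ)
    (hconv : ∀ i, ConvexOn ℝ Set.univ (ℓ i))
    (wh : EuclideanSpace ℝ (Fin d)) (Ct : ℝ) (hCt : 0 < Ct)
    (ξ : Fin n → EuclideanSpace ℝ (Fin d)) (hξ : ∀ i, IsSubgrad (ℓ i) (ξ i) wh)
    (g : EuclideanSpace ℝ (Fin d)) (hg : g = wh + Ct • ∑ i, ξ i)
    (w : EuclideanSpace ℝ (Fin d)) (hw : ∀ v, F ℓ Ct w ≤ F ℓ Ct v) :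
    ‖wh - w‖ ^ 2 ≤ ⟪g, wh - w⟫ := by
  obtain ⟨D, hD⟩ : ∃ D, D = wh - w := ⟨_, rfl⟩
  have hwh : wh = w + D := by rw [hD]; abel
  rw [← hD]
  have key : ∀ t : ℝ, 0 < t → t < 1 →
      0 ≤ ⟪w, D⟫ + t / 2 * ‖D‖ ^ 2 + Ct * (∑ i, ℓ i wh - ∑ i, ℓ i w) := by
    intro t ht ht1
    have h1 := hw (w + t • D)
    have h2 : ∑ i, ℓ i (w + t • D) ≤ (1 - t) * ∑ i, ℓ i w + t * ∑ i, ℓ i wh := by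
      rw [Finset.mul_sum, Finset.mul_sum, ← Finset.sum_add_distrib]
      refine Finset.sum_le_sum fun i _ => ?_
      have := (hconv i).2 (Set.mem_univ w) (Set.mem_univ wh)
        (by linarith : (0 : ℝ) ≤ 1 - t) ht.le (by ring)
      have e : (1 - t) • w + t • wh = w + t • D := by rw [hwh]; module
      rw [e] at this
      simpa using this
    have h3 := mul_le_mul_of_nonneg_left h2 hCt.le
    unfold F at h1
    have h4 : ‖w + t • D‖ ^ 2 = ‖w‖ ^ 2 + 2 * (t * ⟪w, D⟫) + t ^ 2 * ‖D‖ ^ 2 := by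
      rw [norm_add_sq_real, real_inner_smul_right, norm_smul, mul_pow, Real.norm_eq_abs, sq_abs]
    rw [h4] at h1
    refine nonneg_of_mul_nonneg_right (a := t) ?_ ht
    linarith
  have h5 : 0 ≤ ⟪w, D⟫ + Ct * (∑ i, ℓ i wh - ∑ i, ℓ i w) := by
    obtain ⟨s, hs⟩ : ∃ s, s = ⟪w, D⟫ + Ct * (∑ i, ℓ i wh - ∑ i, ℓ i w) := ⟨_, rfl⟩
    rw [← hs]
    by_contra hneg
    push Not at hneg
    have hq : 0 ≤ ‖D‖ ^ 2 := by positivity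
    have hpos : 0 < ‖D‖ ^ 2 - 2 * s := by linarith
    have hk := key (-s / (‖D‖ ^ 2 - 2 * s)) (div_pos (by linarith) hpos)
      (by rw [div_lt_one hpos]; linarith)
    have hle : -s / (‖D‖ ^ 2 - 2 * s) * ‖D‖ ^ 2 ≤ -s := by
      rw [div_mul_eq_mul_div, div_le_iff₀ hpos]
      nlinarith
    linarith
  have h6 : ∑ i, ℓ i wh - ∑ i, ℓ i w ≤ ⟪∑ i, ξ i, D⟫ := by
    rw [sum_inner, ← Finset.sum_sub_distrib]
    refine Finset.sum_le_sum fun i _ => ?_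
    have := hξ i w
    have e : w - wh = -D := by rw [hD]; abel
    rw [e, inner_neg_right] at this
    linarith
  have h7 := mul_le_mul_of_nonneg_left h6 hCt.le
  rw [hg, inner_add_left, real_inner_smul_left]
  have h8 : ⟪wh, D⟫ = ⟪w, D⟫ + ‖D‖ ^ 2 := by
    rw [hwh, inner_add_left, real_inner_self_eq_norm_sq]
  linarith

/-- A ball estimate for linear functionals. -/
theorem inner_aux {d : ℕ} (g D x : EuclideanSpace ℝ (Fin d)) (h : ‖D‖ ^ 2 ≤ ⟪g, D⟫) :
    ⟪D, x⟫ ≤ alph g x ∧ -bet g x ≤ ⟪D, x⟫ := by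
  have h1 : ‖(2 : ℝ) • D - g‖ ≤ ‖g‖ := by
    refine le_of_sq_le_sq ?_ (norm_nonneg _)
    rw [norm_sub_sq_real, norm_smul, real_inner_smul_left, real_inner_comm, mul_pow]
    norm_num
    linarith
  have h2 := abs_le.1 ((abs_real_inner_le_norm ((2 : ℝ) • D - g) x).trans
    (mul_le_mul_of_nonneg_right h1 (norm_nonneg x)))
  rw [inner_sub_left, real_inner_smul_left] at h2
  unfold alph bet
  constructor <;> linarith [h2.1, h2.2]

theorem stmt14 {d n : ℕ} (ℓ : Fin n → EuclideanSpace ℝ (Fin d) → ℝ)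
    (hconv : ∀ i, ConvexOn ℝ Set.univ (ℓ i))
    (wh : EuclideanSpace ℝ (Fin d)) (Ct : ℝ) (hCt : 0 < Ct)
    (ξ : Fin n → EuclideanSpace ℝ (Fin d)) (hξ : ∀ i, IsSubgrad (ℓ i) (ξ i) wh)
    (g : EuclideanSpace ℝ (Fin d)) (hg : g = wh + Ct • ∑ i, ξ i)
    (n' : ℕ) (x' : Fin n' → EuclideanSpace ℝ (Fin d)) (y' : Fin n' → ℝ)
    (hy : ∀ i, y' i = 1 ∨ y' i = -1)
    (w : EuclideanSpace ℝ (Fin d)) (hw : ∀ v, F ℓ Ct w ≤ F ℓ Ct v) :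
    {i : Fin n' | y' i * ⟪w, x' i⟫ < 0}.ncard +
    ({i : Fin n' | y' i = 1 ∧ 0 ≤ ⟪wh, x' i⟫ - alph g (x' i)}.ncard +
     {i : Fin n' | y' i = -1 ∧ ⟪wh, x' i⟫ + bet g (x' i) ≤ 0}.ncard) ≤ n' := by
  have hb := ball_aux ℓ hconv wh Ct hCt ξ hξ g hg w hw
  have hlin : ∀ x, ⟪w, x⟫ = ⟪wh, x⟫ - ⟪wh - w, x⟫ := by
    intro x
    rw [inner_sub_left]; ring
  rw [← Set.ncard_union_eq, ← Set.ncard_union_eq]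
  · calc _ ≤ (Set.univ : Set (Fin n')).ncard := Set.ncard_le_ncard (Set.subset_univ _)
      _ = n' := by simp [Set.ncard_univ]
  · rw [Set.disjoint_left]
    rintro i hi (⟨h1, h2⟩ | ⟨h1, h2⟩)
    · have := (inner_aux g (wh - w) (x' i) hb).1
      simp only [Set.mem_ofPred_eq, h1, hlin] at hi
      linarith
    · have := (inner_aux g (wh - w) (x' i) hb).2
      simp only [Set.mem_ofPred_eq, h1, hlin] at hi
      linarith
  · rw [Set.disjoint_left]
    rintro i ⟨h1, _⟩ ⟨h2, _⟩
    linarith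
end
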